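/- For all real numbers α, β, x, y and every natural number n, ∑_{k=0}^{n} B(α,n−k) · B(β+k,k) · x^k · y^{n−k} = ∑_{k=0}^{n} B(β−α+n,n−k) · B(α,k) · x^{n−k} · (x+y)^k. -/

import Mathlib

open Finset

/-- The generalized binomial coefficient `B(α, k) = (∏_{i=0}^{k-1} (α - i)) / k!`. -/
noncomputable def genBinom (α : ℝ) (k : ℕ) : ℝ :=
  (∏ i ∈ Finset.range k, (α - i)) / k.factorial

lemma genBinom_eq_choose (a : ℝ) (k : ℕ) : genBinom a k = Ring.choose a k := by
  rw [Ring.choose_eq_smul, genBinom, ← Polynomial.aeval_eq_smeval, Polynomial.aeval_def,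
    ← Polynomial.eval_map, descPochhammer_map, descPochhammer_eval_eq_prod_range, smul_eq_mul,
    div_eq_inv_mul]

lemma genBinom_vandermonde (a b : ℝ) (k : ℕ) :
    genBinom (a + b) k = ∑ ij ∈ antidiagonal k, genBinom a ij.1 * genBinom b ij.2 := by
  simp only [genBinom_eq_choose]
  exact Ring.add_choose_eq k (Commute.all a b)

lemma genBinom_mul_choose (a : ℝ) (m j : ℕ) :
    genBinom a (m + j) * ((m + j).choose m : ℝ) = genBinom a j * genBinom (a - j) m := by
  have h : ((m + j).choose m : ℝ) * m.factorial * j.factorial = (m + j).factorial := by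
    rw [Nat.choose_symm_add]
    exact_mod_cast Nat.add_choose_mul_factorial_mul_factorial m j
  have h1 : (m.factorial : ℝ) ≠ 0 := by exact_mod_cast m.factorial_ne_zero
  have h2 : (j.factorial : ℝ) ≠ 0 := by exact_mod_cast j.factorial_ne_zero
  have h3 : ((m + j).factorial : ℝ) ≠ 0 := by exact_mod_cast (m + j).factorial_ne_zero
  have hp : ∏ i ∈ Finset.range (m + j), (a - i) =
      (∏ i ∈ Finset.range j, (a - i)) * ∏ i ∈ Finset.range m, (a - j - i) := by
    rw [add_comm, Finset.prod_range_add]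
    congr 1
    refine Finset.prod_congr rfl fun i _ => ?_
    push_cast
    ring
  unfold genBinom
  rw [hp]
  field_simp
  rw [← h]
  ring

/-- Munarini's second identity. -/
theorem munarini_second (α β x y : ℝ) (n : ℕ) :
    ∑ k ∈ Finset.range (n + 1),
      genBinom α (n - k) * genBinom (β + k) k * x ^ k * y ^ (n - k) =
    ∑ k ∈ Finset.range (n + 1),
      genBinom (β - α + n) (n - k) * genBinom α k * x ^ (n - k) * (x + y) ^ k := by
  rw [← Finset.Nat.sum_antidiagonal_eq_sum_range_succ
      (fun a b => genBinom α b * genBinom (β + a) a * x ^ a * y ^ b) n,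
    ← Finset.Nat.sum_antidiagonal_eq_sum_range_succ
      (fun k p => genBinom (β - α + n) p * genBinom α k * x ^ p * (x + y) ^ k) n]
  have hL : ∀ q ∈ antidiagonal n, genBinom α q.2 * genBinom (β + q.1) q.1 * x ^ q.1 * y ^ q.2 =
      ∑ r ∈ antidiagonal q.1, genBinom α q.2 *
        (genBinom (β - α + n) r.1 * genBinom (α - q.2) r.2) * x ^ (r.1 + r.2) * y ^ q.2 := by
    intro q hq
    have hn : (n : ℝ) = q.1 + q.2 := by
      exact_mod_cast (mem_antidiagonal.mp hq).symm
    have : β + (q.1 : ℝ) = (β - α + n) + (α - q.2) := by rw [hn]; ring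
    rw [this, genBinom_vandermonde, Finset.mul_sum, Finset.sum_mul, Finset.sum_mul]
    refine Finset.sum_congr rfl fun r hr => ?_
    rw [mem_antidiagonal.mp hr]
  have hR : ∀ q ∈ antidiagonal n,
      genBinom (β - α + n) q.2 * genBinom α q.1 * x ^ q.2 * (x + y) ^ q.1 =
      ∑ r ∈ antidiagonal q.1, genBinom α r.2 *
        (genBinom (β - α + n) q.2 * genBinom (α - r.2) r.1) * x ^ (q.2 + r.1) * y ^ r.2 := by
    intro q hq
    rw [(Commute.all x y).add_pow', Finset.mul_sum]
    refine Finset.sum_congr rfl fun r hr => ?_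
    have h := genBinom_mul_choose α r.1 r.2
    rw [mem_antidiagonal.mp hr] at h
    rw [nsmul_eq_mul, pow_add]
    linear_combination (genBinom (β - α + n) q.2 * x ^ q.2 * x ^ r.1 * y ^ r.2) * h
  rw [Finset.sum_congr rfl hL, Finset.sum_congr rfl hR, Finset.sum_sigma', Finset.sum_sigma']
  refine Finset.sum_nbij'
    (fun s => ⟨(s.2.2 + s.1.2, s.2.1), (s.2.2, s.1.2)⟩)
    (fun s => ⟨(s.1.2 + s.2.1, s.2.2), (s.1.2, s.2.1)⟩) ?_ ?_ ?_ ?_ ?_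
  · rintro ⟨⟨a, b⟩, ⟨c, d⟩⟩ h
    simp only [mem_sigma, HasAntidiagonal.mem_antidiagonal] at h ⊢
    exact ⟨by omega, by trivial⟩
  · rintro ⟨⟨a, b⟩, ⟨c, d⟩⟩ h
    simp only [mem_sigma, HasAntidiagonal.mem_antidiagonal] at h ⊢
    exact ⟨by omega, by trivial⟩
  · rintro ⟨⟨a, b⟩, ⟨c, d⟩⟩ h
    simp only [mem_sigma, HasAntidiagonal.mem_antidiagonal] at h
    obtain ⟨h1, rfl⟩ := h
    rfl
  · rintro ⟨⟨a, b⟩, ⟨c, d⟩⟩ h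
    simp only [mem_sigma, HasAntidiagonal.mem_antidiagonal] at h
    obtain ⟨h1, rfl⟩ := h
    rfl
  · rintro ⟨⟨a, b⟩, ⟨c, d⟩⟩ h
    rfl
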